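/- Let n ≥ 2, k ≥ 1 and m ≥ 1 be integers. Let v = (G, F) be a holomorphic vector field on a neighborhood of 0 in ℂ^{n−1} × ℂ with G(y,t) = B·y + R(y,t), ‖R(y,t)‖ ≤ C(‖y‖² + ‖y‖·|t| + |t|^{m+1}) near 0, and F(y,t) = t^{k+1} + R₀(y,t), |R₀(y,t)| ≤ C‖y‖² near 0, where B is an invertible complex (n−1)×(n−1) matrix. Let S be a good sector for (B,k) and r > 0. Suppose q : S^r → ℂ^{n−1} is holomorphic, extends continuously to 0 with q(0) = 0, has bounded derivative on S^r, and its graph is tangent to v, i.e. q′(t)·F(q(t), t) = G(q(t), t) for all t ∈ S^r. Then q(t) = o(|t|^m) as t → 0 in S^r. -/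

import Mathlib

noncomputable section

open Complex Set Filter Metric Asymptotics

/-- The open radial sector of directions strictly between `a` and `b`. -/
def Sector (a b : ℝ) : Set ℂ :=
  {z | ∃ ρ φ : ℝ, 0 < ρ ∧ a < φ ∧ φ < b ∧ z = ρ * Complex.exp (φ * Complex.I)}

/-- The sector truncated at radius `r`. -/
def SectorR (a b r : ℝ) : Set ℂ := Sector a b ∩ Metric.ball 0 r

/-- A good sector for `(B, k)`. -/
def IsGoodSectorFor {m : ℕ} (k : ℕ) (B : Matrix (Fin m) (Fin m) ℂ) (a b : ℝ) : Prop :=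
  a < b ∧ b - a ≤ 2 * Real.pi ∧
  ∀ bv ∈ spectrum ℂ B,
    (∃! φ : ℝ, φ ∈ Set.Icc a b ∧ (bv * Complex.exp (-(k : ℂ) * (φ : ℂ) * Complex.I)).re = 0) ∧
    (∀ φ ∈ Set.Icc a b,
      (bv * Complex.exp (-(k : ℂ) * (φ : ℂ) * Complex.I)).re = 0 → a < φ ∧ φ < b)

/-- A set of vectors on which `f` acts as a Jordan form whose off-diagonal entries are all `ε`. -/
def IsJordanChainSet {K V : Type*} [Field K] [AddCommGroup V] [Module K V]
    (f : Module.End K V) (ε : K) (s : Set V) : Prop :=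
  ∀ w ∈ s, ∃ μ : K, f.HasEigenvalue μ ∧ ∃ w' ∈ insert 0 s, f w = μ • w + ε • w'

theorem IsJordanChainSet.union {K V : Type*} [Field K] [AddCommGroup V] [Module K V]
    {f : Module.End K V} {ε : K} {s t : Set V} (hs : IsJordanChainSet f ε s)
    (ht : IsJordanChainSet f ε t) : IsJordanChainSet f ε (s ∪ t) := by
  rintro w (hw | hw)
  · obtain ⟨μ, hμ, w', hw', h⟩ := hs w hw
    exact ⟨μ, hμ, w', insert_subset_insert subset_union_left hw', h⟩
  · obtain ⟨μ, hμ, w', hw', h⟩ := ht w hw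
    exact ⟨μ, hμ, w', insert_subset_insert subset_union_right hw', h⟩

theorem exists_isJordanChainSet_of_mem_maxGenEigenspace {K V : Type*} [Field K] [AddCommGroup V]
    [Module K V] {f : Module.End K V} {ε : K} (hε : ε ≠ 0) {μ : K} {v : V}
    (hv : v ∈ f.maxGenEigenspace μ) :
    ∃ s : Set V, s.Finite ∧ IsJordanChainSet f ε s ∧ v ∈ Submodule.span K s := by
  by_cases hv0 : v = 0
  · exact ⟨∅, finite_empty, fun w hw => hw.elim, hv0 ▸ Submodule.zero_mem _⟩
  have hμ : f.HasEigenvalue μ := by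
    have h : f.HasUnifEigenvalue μ ⊤ := fun h => hv0 (by
      have h' : f.maxGenEigenspace μ = ⊥ := h
      simpa [h'] using hv)
    exact h.lt zero_lt_one
  obtain ⟨p, hp⟩ := Module.End.mem_maxGenEigenspace f μ v |>.1 hv
  set g := f - μ • (1 : Module.End K V) with hg
  refine ⟨(fun j : ℕ => (ε⁻¹) ^ j • (g ^ j) v) '' Set.Iic p, (finite_Iic p).image _, ?_, ?_⟩
  · rintro _ ⟨j, hj, rfl⟩
    refine ⟨μ, hμ, (ε⁻¹) ^ (j + 1) • (g ^ (j + 1)) v, ?_, ?_⟩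
    · rcases (show j ≤ p from hj).lt_or_eq with hlt | rfl
      · exact Or.inr ⟨j + 1, hlt, rfl⟩
      · left
        simp [pow_succ' g, hp]
    · have hfg : f = g + μ • (1 : Module.End K V) := by simp [hg]
      change f (ε⁻¹ ^ j • (g ^ j) v) = μ • ε⁻¹ ^ j • (g ^ j) v + ε • ε⁻¹ ^ (j + 1) • (g ^ (j + 1)) v
      rw [pow_succ' g, Module.End.mul_apply]
      generalize (g ^ j) v = x
      rw [hfg, smul_smul ε, pow_succ' ε⁻¹, ← mul_assoc, mul_inv_cancel₀ hε, one_mul]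
      simp [add_comm, smul_comm μ]
  · exact Submodule.subset_span ⟨0, Nat.zero_le p, by simp⟩

theorem exists_isJordanChainSet_span_eq_top {K V : Type*} [Field K] [IsAlgClosed K]
    [AddCommGroup V] [Module K V] [FiniteDimensional K V] (f : Module.End K V) {ε : K}
    (hε : ε ≠ 0) :
    ∃ s : Set V, s.Finite ∧ IsJordanChainSet f ε s ∧ Submodule.span K s = ⊤ := by
  let U : Submodule K V :=
    { carrier := {v | ∃ s : Set V, s.Finite ∧ IsJordanChainSet f ε s ∧ v ∈ Submodule.span K s}
      zero_mem' := ⟨∅, finite_empty, fun w hw => hw.elim, Submodule.zero_mem _⟩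
      add_mem' := by
        rintro v w ⟨s, hs, hs', hv⟩ ⟨t, ht, ht', hw⟩
        exact ⟨s ∪ t, hs.union ht, hs'.union ht',
          add_mem (Submodule.span_mono subset_union_left hv)
            (Submodule.span_mono subset_union_right hw)⟩
      smul_mem' := by
        rintro c v ⟨s, hs, hs', hv⟩
        exact ⟨s, hs, hs', Submodule.smul_mem _ c hv⟩ }
  have hU : U = ⊤ := by
    rw [eq_top_iff, ← Module.End.iSup_maxGenEigenspace_eq_top f]
    exact iSup_le fun μ v hv => exists_isJordanChainSet_of_mem_maxGenEigenspace hε hv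
  have hmem : ∀ v : V, ∃ s : Set V, s.Finite ∧ IsJordanChainSet f ε s ∧
      v ∈ Submodule.span K s := fun v => (hU ▸ Submodule.mem_top : v ∈ U)
  choose s hs hs' hv using hmem
  let e := Module.finBasis K V
  refine ⟨⋃ i, s (e i), finite_iUnion fun i => hs _, ?_, ?_⟩
  · intro w hw
    obtain ⟨i, hi⟩ := mem_iUnion.1 hw
    obtain ⟨μ, hμ, w', hw', h⟩ := hs' _ w hi
    exact ⟨μ, hμ, w', insert_subset_insert (subset_iUnion (fun i => s (e i)) i) hw', h⟩
  · rw [eq_top_iff, ← e.span_eq, Submodule.span_le]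
    rintro _ ⟨i, rfl⟩
    exact Submodule.span_mono (subset_iUnion (fun i => s (e i)) i) (hv (e i))

theorem Matrix.spectrum_transpose' {K n : Type*} [Field K] [Fintype n] [DecidableEq n]
    (B : Matrix n n K) : spectrum K B.transpose = spectrum K B := by
  ext μ
  rw [spectrum.mem_iff, spectrum.mem_iff, ← Matrix.isUnit_transpose]
  simp [Matrix.algebraMap_eq_diagonal]

/-- Coordinates in which `B` is diagonal up to an error of relative size `ε`. -/
theorem Matrix.exists_injective_almost_diagonal {N : ℕ} (B : Matrix (Fin N) (Fin N) ℂ) {ε : ℝ}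
    (hε : 0 < ε) :
    ∃ (ι : Type) (_ : Fintype ι) (L : (Fin N → ℂ) →ₗ[ℂ] (ι → ℂ)) (d : ι → ℂ),
      Function.Injective L ∧ (∀ i, d i ∈ spectrum ℂ B) ∧
      ∀ v i, ‖L (B.mulVec v) i - d i * L v i‖ ≤ ε * ‖L v‖ := by
  obtain ⟨s, hs, hJ, hspan⟩ := exists_isJordanChainSet_span_eq_top
    (Matrix.toLin' B.transpose) (ε := (ε : ℂ)) (by exact_mod_cast hε.ne')
  have := hs.fintype
  choose! d hd w' hw' hdw using hJ
  let L : (Fin N → ℂ) →ₗ[ℂ] (s → ℂ) := LinearMap.pi fun w => dotProductBilin ℂ ℂ w.1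
  have hL : ∀ v (w : s), L v w = w.1 ⬝ᵥ v := fun v w => rfl
  refine ⟨s, inferInstance, L, fun w => d w, ?_, fun w => ?_, fun v w => ?_⟩
  · refine (injective_iff_map_eq_zero L).2 fun v hv => ?_
    have h : ∀ w : Fin N → ℂ, w ⬝ᵥ v = 0 := fun w => by
      have hw : w ∈ Submodule.span ℂ s := hspan ▸ Submodule.mem_top
      induction hw using Submodule.span_induction with
      | mem w hw => rw [← hL v ⟨w, hw⟩, hv]; rfl
      | zero => simp
      | add x y _ _ hx hy => simp [add_dotProduct, hx, hy]
      | smul c x _ hx => simp [smul_dotProduct, hx]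
    exact dotProduct_eq_zero v fun w => by rw [dotProduct_comm]; exact h w
  · rw [← Matrix.spectrum_transpose', ← Matrix.spectrum_toLin']
    exact (hd w w.2).mem_spectrum
  · have h1 : L (B.mulVec v) w - d w * L v w = ε * (w' w ⬝ᵥ v) := by
      rw [hL, hL, Matrix.dotProduct_mulVec, ← Matrix.mulVec_transpose, ← Matrix.toLin'_apply,
        hdw w w.2]
      simp [add_dotProduct, smul_dotProduct]
    rw [h1, norm_mul, Complex.norm_real, Real.norm_of_nonneg hε.le]
    refine mul_le_mul_of_nonneg_left ?_ hε.le
    rcases hw' w w.2 with h0 | hmem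
    · simp [h0]
    · exact norm_le_pi_norm (L v) ⟨w' w, hmem⟩

theorem isOpen_sector (a b : ℝ) : IsOpen (Sector a b) := by
  rw [isOpen_iff_mem_nhds]
  rintro t ⟨ρ, φ, hρ, ha, hb, rfl⟩
  set t := (ρ : ℂ) * exp (φ * I) with ht
  have ht0 : t ≠ 0 := mul_ne_zero (by exact_mod_cast hρ.ne') (exp_ne_zero _)
  have hu : Tendsto (fun w : ℂ => w / t) (nhds t) (nhds 1) := by
    have : ContinuousAt (fun w : ℂ => w / t) t := by fun_prop (disch := exact ht0)
    simpa [ContinuousAt, div_self ht0] using this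
  have harg : Tendsto (fun w : ℂ => φ + arg (w / t)) (nhds t) (nhds φ) := by
    have := ((continuousAt_arg one_mem_slitPlane).tendsto.comp hu).const_add φ
    simpa using this
  filter_upwards [harg.eventually (lt_mem_nhds ha), harg.eventually (gt_mem_nhds hb),
    eventually_ne_nhds ht0] with w h1 h2 h3
  refine ⟨ρ * ‖w / t‖, φ + arg (w / t), mul_pos hρ (norm_pos_iff.2 (div_ne_zero h3 ht0)),
    h1, h2, ?_⟩
  calc w = t * (‖w / t‖ * exp (arg (w / t) * I)) := by
        rw [norm_mul_exp_arg_mul_I, mul_div_cancel₀ _ ht0]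
    _ = _ := by
        rw [ht]; push_cast; rw [add_mul, exp_add]; ring

theorem isOpen_sectorR (a b r : ℝ) : IsOpen (SectorR a b r) :=
  (isOpen_sector a b).inter isOpen_ball

theorem norm_polar {ρ : ℝ} (hρ : 0 ≤ ρ) (φ : ℝ) : ‖(ρ : ℂ) * exp (φ * I)‖ = ρ := by
  rw [norm_mul, norm_exp_ofReal_mul_I, mul_one, norm_real, Real.norm_of_nonneg hρ]

theorem polar_mem_sectorR {a b r ρ φ : ℝ} (hρ : 0 < ρ) (hr : ρ < r) (hφ : φ ∈ Ioo a b) :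
    (ρ : ℂ) * exp (φ * I) ∈ SectorR a b r :=
  ⟨⟨ρ, φ, hρ, hφ.1, hφ.2, rfl⟩, mem_ball_zero_iff.2 ((norm_polar hρ.le φ).trans_lt hr)⟩

theorem exists_polar_of_mem_sectorR {a b r : ℝ} {t : ℂ} (ht : t ∈ SectorR a b r) :
    ∃ ρ φ : ℝ, 0 < ρ ∧ ρ < r ∧ φ ∈ Ioo a b ∧ t = ρ * exp (φ * I) := by
  obtain ⟨⟨ρ, φ, hρ, ha, hb, rfl⟩, h⟩ := ht
  exact ⟨ρ, φ, hρ, (norm_polar hρ.le φ).symm.trans_lt (mem_ball_zero_iff.1 h), ⟨ha, hb⟩, rfl⟩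

theorem hasDerivAt_polar_radius (ρ φ : ℝ) :
    HasDerivAt (fun x : ℝ => (x : ℂ) * exp (φ * I)) (exp (φ * I)) ρ := by
  simpa using (Complex.ofRealCLM.hasDerivAt (x := ρ)).mul_const (exp (φ * I))

theorem hasDerivAt_polar_angle (ρ φ : ℝ) :
    HasDerivAt (fun x : ℝ => (ρ : ℂ) * exp (x * I)) (ρ * exp (φ * I) * I) φ := by
  have h := ((Complex.ofRealCLM.hasDerivAt (x := φ)).mul_const I).cexp.const_mul (ρ : ℂ)
  simpa [mul_assoc] using h

/-- A function with bounded derivative on a sector which vanishes at the vertex is dominated by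
the distance to the vertex. -/
theorem norm_le_mul_norm_of_norm_deriv_le {E : Type*} [NormedAddCommGroup E] [NormedSpace ℂ E]
    {a b r M : ℝ} {q q' : ℂ → E} (hq : ∀ t ∈ SectorR a b r, HasDerivAt q (q' t) t)
    (hM : ∀ t ∈ SectorR a b r, ‖q' t‖ ≤ M)
    (hq0 : Tendsto q (nhdsWithin 0 (SectorR a b r)) (nhds 0)) {t : ℂ}
    (ht : t ∈ SectorR a b r) : ‖q t‖ ≤ M * ‖t‖ := by
  obtain ⟨ρ, φ, hρ, hρr, hφ, rfl⟩ := exists_polar_of_mem_sectorR ht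
  rw [norm_polar hρ.le]
  have hM0 : 0 ≤ M := (norm_nonneg _).trans (hM _ ht)
  set γ : ℝ → E := fun x => q (x * exp (φ * I)) with hγ
  have hmem : ∀ x ∈ Ioc 0 ρ, (x : ℂ) * exp (φ * I) ∈ SectorR a b r := fun x hx =>
    polar_mem_sectorR hx.1 (hx.2.trans_lt hρr) hφ
  have hd : ∀ x ∈ Ioc 0 ρ, HasDerivWithinAt γ (exp (φ * I) • q' (x * exp (φ * I))) (Ioc 0 ρ) x :=
    fun x hx => ((hq _ (hmem x hx)).scomp x (hasDerivAt_polar_radius x φ)).hasDerivWithinAt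
  have hbd : ∀ x ∈ Ioc 0 ρ, ‖γ ρ - γ x‖ ≤ M * ρ := fun x hx => by
    refine ((convex_Ioc 0 ρ).norm_image_sub_le_of_norm_hasDerivWithin_le hd (C := M) ?_ hx
      ⟨hρ, le_rfl⟩).trans ?_
    · intro y hy
      rw [norm_smul, norm_exp_ofReal_mul_I, one_mul]
      exact hM _ (hmem y hy)
    · rw [Real.norm_of_nonneg (sub_nonneg.2 hx.2)]
      exact mul_le_mul_of_nonneg_left (by linarith [hx.1]) hM0
  have hlim : Tendsto γ (nhdsWithin 0 (Ioi 0)) (nhds 0) := by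
    refine hq0.comp (tendsto_nhdsWithin_iff.2 ⟨?_, ?_⟩)
    · have : Continuous fun x : ℝ => (x : ℂ) * exp (φ * I) := by fun_prop
      simpa using (this.tendsto 0).mono_left nhdsWithin_le_nhds
    · filter_upwards [Ioc_mem_nhdsGT hρ] with x hx using hmem x hx
  have h := (hlim.const_sub (γ ρ)).norm
  rw [sub_zero] at h
  exact le_of_tendsto h (by filter_upwards [Ioc_mem_nhdsGT hρ] with x hx using hbd x hx)

theorem mul_norm_sq_le_of_critical {k : ℕ} {ρ φ c e A : ℝ} {d w w' : ℂ} (hρ : 0 ≤ ρ)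
    (hA : ρ ^ k * A ≤ c / 4)
    (hre : |(((ρ : ℂ) * exp (φ * I) * w') * (starRingEnd ℂ) w).re| ≤ A * ‖w‖ ^ 2)
    (hc : c ≤ |(d * exp (-k * φ * I)).re| ∨
      (((ρ : ℂ) * exp (φ * I) * w') * (starRingEnd ℂ) w).im = 0 ∧ c ≤ ‖d‖)
    (he : ‖((ρ : ℂ) * exp (φ * I)) ^ (k + 1) * w' - d * w‖ ≤ e) :
    c * ‖w‖ ^ 2 ≤ c / 4 * ‖w‖ ^ 2 + ‖w‖ * e := by
  set X := ((ρ : ℂ) * exp (φ * I) * w') * (starRingEnd ℂ) w with hX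
  set err := ((ρ : ℂ) * exp (φ * I)) ^ (k + 1) * w' - d * w with herr
  set ω := exp (-k * φ * I) with hω
  have hωn : ‖ω‖ = 1 := by
    have : (-k * φ * I : ℂ) = ((-k * φ : ℝ) : ℂ) * I := by push_cast; ring
    rw [hω, this, norm_exp_ofReal_mul_I]
  have hωk : ω * exp (φ * I) ^ k = 1 := by
    rw [hω, ← exp_nat_mul, ← exp_add]
    convert exp_zero using 2
    ring
  have hww : w * (starRingEnd ℂ) w = ((‖w‖ ^ 2 : ℝ) : ℂ) := by
    rw [mul_conj, normSq_eq_norm_sq]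
  have key : ((‖w‖ ^ 2 : ℝ) : ℂ) * (d * ω)
      = ((ρ ^ k : ℝ) : ℂ) * X - ω * (starRingEnd ℂ) w * err := by
    have h1 : ω * ((ρ : ℂ) * exp (φ * I)) ^ (k + 1)
        = (ρ : ℂ) ^ k * (ρ * exp (φ * I)) := by
      calc _ = (ω * exp (φ * I) ^ k) * ((ρ : ℂ) ^ k * (ρ * exp (φ * I))) := by ring
        _ = _ := by rw [hωk, one_mul]
    rw [← hww, hX, herr]
    push_cast
    linear_combination ((starRingEnd ℂ) w * w') * h1
  have herr' : ‖ω * (starRingEnd ℂ) w * err‖ ≤ ‖w‖ * e := by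
    rw [norm_mul, norm_mul, hωn, one_mul, RCLike.norm_conj]
    exact mul_le_mul_of_nonneg_left he (norm_nonneg _)
  have hXle : ρ ^ k * |X.re| ≤ c / 4 * ‖w‖ ^ 2 := by
    calc ρ ^ k * |X.re| ≤ ρ ^ k * (A * ‖w‖ ^ 2) :=
          mul_le_mul_of_nonneg_left hre (pow_nonneg hρ k)
      _ = ρ ^ k * A * ‖w‖ ^ 2 := by ring
      _ ≤ _ := mul_le_mul_of_nonneg_right hA (sq_nonneg _)
  rcases hc with hc | ⟨him, hc⟩
  · have h := congrArg Complex.re key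
    rw [re_ofReal_mul, sub_re, re_ofReal_mul] at h
    have h2 := congrArg abs h
    rw [abs_mul, abs_of_nonneg (sq_nonneg ‖w‖)] at h2
    calc c * ‖w‖ ^ 2 ≤ ‖w‖ ^ 2 * |(d * ω).re| := by
          rw [mul_comm]; exact mul_le_mul_of_nonneg_left hc (sq_nonneg _)
      _ ≤ |ρ ^ k * X.re| + |(ω * (starRingEnd ℂ) w * err).re| := h2 ▸ abs_sub _ _
      _ ≤ _ := by
          rw [abs_mul, abs_of_nonneg (pow_nonneg hρ k)]
          exact add_le_add hXle ((abs_re_le_norm _).trans herr')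
  · have hXn : ‖X‖ = |X.re| := (abs_re_eq_norm.2 him).symm
    have h2 := congrArg norm key
    rw [norm_mul, norm_mul d, hωn, mul_one, norm_real, Real.norm_of_nonneg (sq_nonneg _)] at h2
    calc c * ‖w‖ ^ 2 ≤ ‖w‖ ^ 2 * ‖d‖ := by
          rw [mul_comm]; exact mul_le_mul_of_nonneg_left hc (sq_nonneg _)
      _ ≤ ‖((ρ ^ k : ℝ) : ℂ) * X‖ + ‖ω * (starRingEnd ℂ) w * err‖ := h2 ▸ norm_sub_le _ _
      _ ≤ _ := by
          rw [norm_mul, norm_real, Real.norm_of_nonneg (pow_nonneg hρ k), hXn]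
          exact add_le_add hXle herr'

/-- If `‖f‖ / (x ^ (m + 1) + η)` is locally maximal along a ray, the radial logarithmic derivative
of `f` is at most `m + 1`. -/
theorem abs_re_le_of_radial_isLocalMax {m : ℕ} {ρ φ N η : ℝ} {f : ℂ → ℂ} {f' : ℂ} (hρ : 0 ≤ ρ)
    (hη : 0 ≤ η) (hf : HasDerivAt f f' (ρ * exp (φ * I)))
    (heq : ‖f (ρ * exp (φ * I))‖ = N * (ρ ^ (m + 1) + η))
    (hmax : ∀ᶠ x : ℝ in nhds ρ, ‖f (x * exp (φ * I))‖ ≤ N * (x ^ (m + 1) + η)) :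
    |(((ρ : ℂ) * exp (φ * I) * f') * (starRingEnd ℂ) (f (ρ * exp (φ * I)))).re|
      ≤ (m + 1) * ‖f (ρ * exp (φ * I))‖ ^ 2 := by
  set w := f (ρ * exp (φ * I)) with hw
  have h1 : HasDerivAt (fun x : ℝ => f (x * exp (φ * I))) (exp (φ * I) * f') ρ :=
    hf.scomp ρ (hasDerivAt_polar_radius ρ φ)
  have h2 : HasDerivAt (fun x : ℝ => (N * (x ^ (m + 1) + η)) ^ 2)
      (2 * (N * (ρ ^ (m + 1) + η)) * (N * ((m + 1) * ρ ^ m))) ρ := by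
    simpa using (((hasDerivAt_pow (m + 1) ρ).add_const η).const_mul N).fun_pow 2
  have hloc : IsLocalMax (fun x : ℝ => ‖f (x * exp (φ * I))‖ ^ 2 - (N * (x ^ (m + 1) + η)) ^ 2)
      ρ := by
    filter_upwards [hmax] with x hx
    rw [← hw, heq, sub_self]
    exact sub_nonpos.2 (pow_le_pow_left₀ (norm_nonneg _) hx 2)
  have h0 := hloc.hasDerivAt_eq_zero (h1.norm_sq.sub h2)
  rw [Complex.inner, ← hw] at h0
  have hX : (((ρ : ℂ) * exp (φ * I) * f') * (starRingEnd ℂ) w).re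
      = ρ * (exp (φ * I) * f' * (starRingEnd ℂ) w).re := by
    rw [← re_ofReal_mul]; congr 1; ring
  have hval : (((ρ : ℂ) * exp (φ * I) * f') * (starRingEnd ℂ) w).re
      = (m + 1) * (N ^ 2 * ((ρ ^ (m + 1) + η) * ρ ^ (m + 1))) := by
    rw [hX, pow_succ ρ m]
    rw [pow_succ ρ m] at h0
    linear_combination ρ / 2 * h0
  have hp : 0 ≤ ρ ^ (m + 1) := pow_nonneg hρ _
  rw [hval, abs_of_nonneg (by positivity), heq, mul_pow]
  gcongr
  nlinarith

theorem im_eq_zero_of_angular_isLocalMax {ρ φ : ℝ} {f : ℂ → ℂ} {f' : ℂ}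
    (hf : HasDerivAt f f' (ρ * exp (φ * I)))
    (hmax : IsLocalMax (fun x : ℝ => ‖f (ρ * exp (x * I))‖) φ) :
    (((ρ : ℂ) * exp (φ * I) * f') * (starRingEnd ℂ) (f (ρ * exp (φ * I)))).im = 0 := by
  have h1 : HasDerivAt (fun x : ℝ => f (ρ * exp (x * I))) (ρ * exp (φ * I) * I * f') φ :=
    hf.scomp φ (hasDerivAt_polar_angle ρ φ)
  have hloc : IsLocalMax (fun x : ℝ => ‖f (ρ * exp (x * I))‖ ^ 2) φ := by
    filter_upwards [hmax] with x hx
    exact pow_le_pow_left₀ (norm_nonneg _) hx 2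
  have h0 := hloc.hasDerivAt_eq_zero h1.norm_sq
  rw [Complex.inner] at h0
  have h3 : (ρ : ℂ) * exp (φ * I) * I * f' * (starRingEnd ℂ) (f (ρ * exp (φ * I)))
      = ((ρ : ℂ) * exp (φ * I) * f') * (starRingEnd ℂ) (f (ρ * exp (φ * I))) * I := by ring
  rw [h3, mul_I_re] at h0
  linarith

theorem exists_norm_le_mul_norm_pow {ι : Type*} [Fintype ι] {a b r R δ c K M : ℝ} {k m : ℕ}
    {z z' : ℂ → ι → ℂ} {d : ι → ℂ}
    (hz : ∀ t ∈ SectorR a b r, HasDerivAt z (z' t) t)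
    (hM : ∀ t ∈ SectorR a b r, ‖z t‖ ≤ M * ‖t‖)
    (hR : 0 < R) (hRr : R < r) (hRk : R ^ k * (m + 1) ≤ c / 4) (hc : 0 < c) (hδ : 0 < δ)
    (hK : 0 ≤ K)
    (hode : ∀ t ∈ SectorR a b r, ‖t‖ ≤ R → ∀ i,
      ‖t ^ (k + 1) * z' t i - d i * z t i‖ ≤ c / 2 * ‖z t‖ + K * ‖t‖ ^ (m + 1))
    (hd : ∀ i, c ≤ ‖d i‖)
    (hdre : ∀ i, ∀ φ ∈ Ioo a b, (φ ≤ a + δ ∨ b - δ ≤ φ) → c ≤ |(d i * exp (-k * φ * I)).re|) :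
    ∃ L : ℝ, ∀ t ∈ SectorR a b R, ‖z t‖ ≤ L * ‖t‖ ^ (m + 1) := by
  set L : ℝ := 4 * K / c + |M| * R / R ^ (m + 1) + 1 with hL
  have hL0 : 0 < L := by positivity
  have hL1 : 4 * K / c ≤ L := by
    have : 0 ≤ |M| * R / R ^ (m + 1) := by positivity
    linarith
  have hL2 : |M| * R ≤ L * R ^ (m + 1) := by
    rw [← div_le_iff₀ (by positivity)]
    have : 0 ≤ 4 * K / c := by positivity
    linarith
  refine ⟨L, fun t ht => ?_⟩
  obtain ⟨ρ, φ, hρ, hρR, hφ, rfl⟩ := exists_polar_of_mem_sectorR ht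
  rw [norm_polar hρ.le]
  suffices h : ∀ η > 0, ‖z (ρ * exp (φ * I))‖ ≤ L * (ρ ^ (m + 1) + η) by
    refine le_of_forall_pos_le_add fun ε hε => (h (ε / L) (by positivity)).trans (le_of_eq ?_)
    field_simp
  intro η hη
  set α := min φ (a + δ) with hα
  set β := max φ (b - δ) with hβ
  have haα : a < α := lt_min hφ.1 (by linarith)
  have hβb : β < b := max_lt hφ.2 (by linarith)
  set τ := min ρ (L * η / (|M| + 1)) with hτ
  have hτ0 : 0 < τ := lt_min hρ (by positivity)
  have hτM : |M| * τ ≤ L * η := by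
    have h1 : τ ≤ L * η / (|M| + 1) := min_le_right _ _
    rw [le_div_iff₀ (by positivity)] at h1
    linarith
  have hmem : ∀ x ∈ Icc τ R, ∀ y ∈ Icc α β, (x : ℂ) * exp (y * I) ∈ SectorR a b r :=
    fun x hx y hy => polar_mem_sectorR (hτ0.trans_le hx.1) (hx.2.trans_lt hRr)
      ⟨haα.trans_le hy.1, hy.2.trans_lt hβb⟩
  have hMabs : ∀ x ∈ Icc τ R, ∀ y ∈ Icc α β, ‖z (x * exp (y * I))‖ ≤ |M| * x := fun x hx y hy => by
    have hx0 := hτ0.le.trans hx.1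
    have h := hM _ (hmem x hx y hy)
    rw [norm_polar hx0] at h
    exact h.trans (mul_le_mul_of_nonneg_right (le_abs_self M) hx0)
  have hg0 : ∀ x ∈ Icc τ R, 0 < x ^ (m + 1) + η := fun x hx => by
    have := hτ0.trans_le hx.1
    positivity
  set Ψ : ℝ × ℝ → ℝ := fun p => ‖z (p.1 * exp (p.2 * I))‖ / (p.1 ^ (m + 1) + η) with hΨ
  have hcont : ContinuousOn Ψ (Icc τ R ×ˢ Icc α β) := by
    refine ContinuousOn.div ?_ (by fun_prop) fun p hp => (hg0 p.1 hp.1).ne'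
    refine (ContinuousOn.comp (t := SectorR a b r)
      (fun t ht => (hz t ht).continuousAt.continuousWithinAt) (by fun_prop) ?_).norm
    exact fun p hp => hmem p.1 hp.1 p.2 hp.2
  have hφmem : φ ∈ Icc α β := ⟨min_le_left _ _, le_max_left _ _⟩
  have hρmem : ρ ∈ Icc τ R := ⟨min_le_left _ _, hρR.le⟩
  obtain ⟨⟨x, y⟩, ⟨hx, hy⟩, hmax⟩ := (isCompact_Icc.prod isCompact_Icc).exists_isMaxOn
    ⟨(ρ, φ), hρmem, hφmem⟩ hcont
  set N := Ψ (x, y) with hN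
  have hle : ∀ x' ∈ Icc τ R, ∀ y' ∈ Icc α β,
      ‖z (x' * exp (y' * I))‖ ≤ N * (x' ^ (m + 1) + η) := fun x' hx' y' hy' => by
    have h : Ψ (x', y') ≤ N := hmax (show (x', y') ∈ Icc τ R ×ˢ Icc α β from ⟨hx', hy'⟩)
    exact (div_le_iff₀ (hg0 x' hx')).1 h
  suffices hNL : N ≤ L from
    (hle ρ hρmem φ hφmem).trans (mul_le_mul_of_nonneg_right hNL (hg0 ρ hρmem).le)
  by_contra! hNL
  have hgx := hg0 x hx
  have hx0 : 0 < x := hτ0.trans_le hx.1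
  have heq : ‖z (x * exp (y * I))‖ = N * (x ^ (m + 1) + η) := (div_mul_cancel₀ _ hgx.ne').symm
  have hbig : L * (x ^ (m + 1) + η) < |M| * x :=
    (mul_lt_mul_of_pos_right hNL hgx).trans_le (heq ▸ hMabs x hx y hy)
  have hxτ : τ < x := by
    refine lt_of_le_of_ne hx.1 fun h => ?_
    have : 0 ≤ L * x ^ (m + 1) := by positivity
    rw [← h] at hbig this
    linarith
  have hxR : x < R := by
    refine lt_of_le_of_ne hx.2 fun h => ?_
    have : 0 ≤ L * η := by positivity
    rw [h] at hbig
    linarith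
  have hwpos : 0 < ‖z (x * exp (y * I))‖ := heq ▸ mul_pos (hL0.trans hNL) hgx
  obtain ⟨i, hi⟩ : ∃ i, ‖z (x * exp (y * I)) i‖ = ‖z (x * exp (y * I))‖ := by
    by_contra! hne
    exact lt_irrefl _ ((pi_norm_lt_iff hwpos).2
      fun i => lt_of_le_of_ne (norm_le_pi_norm _ i) (hne i))
  have hzi := hasDerivAt_pi.1 (hz _ (hmem x hx y hy)) i
  have hy' : y ∈ Ioo a b := ⟨haα.trans_le hy.1, hy.2.trans_lt hβb⟩
  have hre := abs_re_le_of_radial_isLocalMax (m := m) hx0.le hη.le hzi (hi.trans heq) (by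
    filter_upwards [Ioo_mem_nhds hxτ hxR] with x' hx'
    exact (norm_le_pi_norm _ i).trans (hle x' (Ioo_subset_Icc_self hx') y hy))
  have hcase : c ≤ |(d i * exp (-k * y * I)).re| ∨
      (((x : ℂ) * exp (y * I) * z' (x * exp (y * I)) i) *
        (starRingEnd ℂ) (z (x * exp (y * I)) i)).im = 0 ∧ c ≤ ‖d i‖ := by
    by_cases hend : y ≤ a + δ ∨ b - δ ≤ y
    · exact Or.inl (hdre i y hy' hend)
    · push Not at hend
      refine Or.inr ⟨im_eq_zero_of_angular_isLocalMax hzi ?_, hd i⟩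
      filter_upwards [Ioo_mem_nhds ((min_le_right _ _).trans_lt hend.1 : α < y)
        (hend.2.trans_le (le_max_right _ _) : y < β)] with y' hy'
      rw [hi, heq]
      exact (norm_le_pi_norm _ i).trans (hle x hx y' (Ioo_subset_Icc_self hy'))
  have hfin := mul_norm_sq_le_of_critical (k := k) hx0.le
    ((mul_le_mul_of_nonneg_right (pow_le_pow_left₀ hx0.le hx.2 k) (by positivity)).trans hRk)
    hre hcase (hode _ (hmem x hx y hy) ((norm_polar hx0.le y).trans_le hx.2) i)
  rw [hi, norm_polar hx0.le] at hfin
  have h1 : c * ‖z (x * exp (y * I))‖ ≤ 4 * (K * x ^ (m + 1)) := by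
    refine le_of_mul_le_mul_left ?_ hwpos
    linarith
  rw [heq] at h1
  have h2 : 4 * K < c * N := by
    rw [mul_comm c, ← div_lt_iff₀ hc]
    exact hL1.trans_lt hNL
  nlinarith [mul_lt_mul_of_pos_right h2 hgx, mul_nonneg hK hη.le]

theorem exists_pos_le_abs_of_continuousAt {g : ℝ → ℝ} {x : ℝ} (hg : ContinuousAt g x)
    (hx : g x ≠ 0) : ∀ᶠ c in nhdsWithin (0 : ℝ) (Ioi 0), ∀ y, |y - x| ≤ c → c ≤ |g y| := by
  have hx' : 0 < |g x| := abs_pos.2 hx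
  obtain ⟨ε, hε, h⟩ := Metric.eventually_nhds_iff.1
    (hg.abs.tendsto.eventually (lt_mem_nhds (half_lt_self hx')))
  filter_upwards [Ioo_mem_nhdsGT hε, Ioo_mem_nhdsGT (half_pos hx')] with c hc hc' y hy
  exact hc'.2.le.trans (h (hy.trans_lt hc.2)).le

theorem IsGoodSectorFor.exists_pos {N k : ℕ} {B : Matrix (Fin N) (Fin N) ℂ} {a b : ℝ}
    (hgood : IsGoodSectorFor k B a b) (hB : IsUnit B) :
    ∃ c > 0, ∀ bv ∈ spectrum ℂ B, c ≤ ‖bv‖ ∧ ∀ φ ∈ Ioo a b, (φ ≤ a + c ∨ b - c ≤ φ) →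
      c ≤ |(bv * exp (-k * φ * I)).re| := by
  obtain ⟨hab, -, hgood⟩ := hgood
  have hev : ∀ᶠ c in nhdsWithin (0 : ℝ) (Ioi 0), ∀ bv ∈ spectrum ℂ B, c ≤ ‖bv‖ ∧
      ∀ φ ∈ Ioo a b, (φ ≤ a + c ∨ b - c ≤ φ) → c ≤ |(bv * exp (-k * φ * I)).re| := by
    refine (Set.Finite.eventually_all B.finite_spectrum).2 fun bv hbv => ?_
    have hbv0 : bv ≠ 0 := fun h => spectrum.zero_notMem ℂ hB (h ▸ hbv)
    have hcont : Continuous fun φ : ℝ => (bv * exp (-k * φ * I)).re := by fun_prop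
    have ha : (bv * exp (-k * a * I)).re ≠ 0 := fun h =>
      lt_irrefl _ ((hgood bv hbv).2 a ⟨le_rfl, hab.le⟩ h).1
    have hb : (bv * exp (-k * b * I)).re ≠ 0 := fun h =>
      lt_irrefl _ ((hgood bv hbv).2 b ⟨hab.le, le_rfl⟩ h).2
    filter_upwards [exists_pos_le_abs_of_continuousAt hcont.continuousAt ha,
      exists_pos_le_abs_of_continuousAt hcont.continuousAt hb,
      Ioo_mem_nhdsGT (norm_pos_iff.2 hbv0)] with c hca hcb hc
    refine ⟨hc.2.le, fun φ hφ h => h.elim (fun h => hca φ ?_) (fun h => hcb φ ?_)⟩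
    · rw [abs_of_pos (sub_pos.2 hφ.1)]; linarith
    · rw [abs_of_neg (sub_neg.2 hφ.2)]; linarith
  obtain ⟨c, hc, hc0⟩ := (hev.and self_mem_nhdsWithin).exists
  exact ⟨c, hc0, hc⟩

/-- Solutions of the almost linear equation `t ^ (k + 1) * q' = B q + E` on a good sector which
vanish at the vertex decay at the rate of the inhomogeneity. -/
theorem IsGoodSectorFor.exists_norm_le_mul_norm_pow {N k m : ℕ} {B : Matrix (Fin N) (Fin N) ℂ}
    {a b r M K : ℝ} (hgood : IsGoodSectorFor k B a b) (hB : IsUnit B) (hk : 1 ≤ k) (hr : 0 < r)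
    {q q' : ℂ → Fin N → ℂ} (hq : ∀ t ∈ SectorR a b r, HasDerivAt q (q' t) t)
    (hM : ∀ t ∈ SectorR a b r, ‖q t‖ ≤ M * ‖t‖) (hK : 0 ≤ K)
    (hode : ∀ t ∈ SectorR a b r,
      ‖t ^ (k + 1) • q' t - B.mulVec (q t)‖ ≤ K * (‖q t‖ * ‖t‖ + ‖t‖ ^ (m + 1))) :
    ∃ R > 0, ∃ L : ℝ, ∀ t ∈ SectorR a b R, ‖q t‖ ≤ L * ‖t‖ ^ (m + 1) := by
  obtain ⟨c, hc, hspec⟩ := hgood.exists_pos hB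
  obtain ⟨ι, _, L, d, hinj, hd, hL⟩ :=
    B.exists_injective_almost_diagonal (show 0 < c / 4 by positivity)
  obtain ⟨κ, -, hκ⟩ := L.exists_antilipschitzWith (LinearMap.ker_eq_bot.2 hinj)
  have hκ' : ∀ v, ‖v‖ ≤ κ * ‖L v‖ := fun v => by simpa using hκ.le_mul_dist v 0
  let Λ : (Fin N → ℂ) →L[ℂ] (ι → ℂ) := L.toContinuousLinearMap
  have hΛ : ∀ v, ‖L v‖ ≤ ‖Λ‖ * ‖v‖ := Λ.le_opNorm
  have hev : ∀ᶠ R : ℝ in nhdsWithin (0 : ℝ) (Ioi 0),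
      R < r ∧ R ^ k * (m + 1) < c / 4 ∧ ‖Λ‖ * K * κ * R < c / 4 := by
    have h0 : ∀ f : ℝ → ℝ, Continuous f → f 0 = 0 →
        ∀ᶠ R : ℝ in nhdsWithin (0 : ℝ) (Ioi 0), f R < c / 4 := fun f hf hf0 =>
      ((hf.tendsto 0).mono_left nhdsWithin_le_nhds).eventually
        (gt_mem_nhds (by rw [hf0]; positivity))
    filter_upwards [Ioo_mem_nhdsGT hr, h0 (fun R => R ^ k * (m + 1)) (by fun_prop)
      (by simp [(Nat.one_le_iff_ne_zero.1 hk)]), h0 (fun R => ‖Λ‖ * K * κ * R) (by fun_prop)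
      (by simp)] with R h1 h2 h3 using ⟨h1.2, h2, h3⟩
  obtain ⟨R, ⟨hRr, hRk, hRK⟩, hR⟩ := (hev.and self_mem_nhdsWithin).exists
  replace hR : 0 < R := hR
  have hodeL : ∀ t ∈ SectorR a b r, ‖t‖ ≤ R → ∀ i,
      ‖t ^ (k + 1) * L (q' t) i - d i * L (q t) i‖
        ≤ c / 2 * ‖L (q t)‖ + ‖Λ‖ * K * ‖t‖ ^ (m + 1) := fun t ht htR i => by
    set E := t ^ (k + 1) • q' t - B.mulVec (q t) with hE
    have h1 : t ^ (k + 1) * L (q' t) i - d i * L (q t) i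
        = L E i + (L (B.mulVec (q t)) i - d i * L (q t) i) := by
      simp [hE]
    have h2 : ‖L E i‖ ≤ c / 4 * ‖L (q t)‖ + ‖Λ‖ * K * ‖t‖ ^ (m + 1) := by
      calc ‖L E i‖ ≤ ‖Λ‖ * (K * (‖q t‖ * ‖t‖ + ‖t‖ ^ (m + 1))) :=
            (norm_le_pi_norm (L E) i).trans ((hΛ E).trans
              (mul_le_mul_of_nonneg_left (hode t ht) (norm_nonneg Λ)))
        _ ≤ ‖Λ‖ * (K * (κ * ‖L (q t)‖ * R + ‖t‖ ^ (m + 1))) := by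
            have := hκ' (q t)
            gcongr
        _ = (‖Λ‖ * K * κ * R) * ‖L (q t)‖ + ‖Λ‖ * K * ‖t‖ ^ (m + 1) := by ring
        _ ≤ _ := by gcongr
    rw [h1]
    exact (norm_add_le _ _).trans (by linarith [hL (q t) i])
  obtain ⟨L', hL'⟩ := _root_.exists_norm_le_mul_norm_pow (z := fun t => L (q t))
    (z' := fun t => L (q' t)) (d := d) (m := m) (K := ‖Λ‖ * K) (M := ‖Λ‖ * M)
    (fun t ht => Λ.hasFDerivAt.comp_hasDerivAt t (hq t ht))
    (fun t ht => (hΛ _).trans ((mul_le_mul_of_nonneg_left (hM t ht) (norm_nonneg Λ)).trans_eq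
      (mul_assoc _ _ _).symm))
    hR hRr hRk.le hc hc (by positivity) hodeL (fun i => (hspec _ (hd i)).1)
    (fun i => (hspec _ (hd i)).2)
  refine ⟨R, hR, κ * L', fun t ht => (hκ' _).trans ?_⟩
  rw [mul_assoc]
  exact mul_le_mul_of_nonneg_left (hL' t ht) κ.2

theorem stmt15 (n k m : ℕ) (hn : 2 ≤ n) (hk : 1 ≤ k) (hm : 1 ≤ m)
    (B : Matrix (Fin (n - 1)) (Fin (n - 1)) ℂ) (hB : IsUnit B)
    (G : (Fin (n - 1) → ℂ) → ℂ → (Fin (n - 1) → ℂ)) (F : (Fin (n - 1) → ℂ) → ℂ → ℂ)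
    (ρ₀ : ℝ) (hρ₀ : 0 < ρ₀)
    (hGF : DifferentiableOn ℂ (fun p : (Fin (n - 1) → ℂ) × ℂ => (G p.1 p.2, F p.1 p.2))
      (Metric.ball 0 ρ₀ ×ˢ Metric.ball 0 ρ₀))
    (C : ℝ)
    (hest : ∃ ρ₁ : ℝ, 0 < ρ₁ ∧ ρ₁ ≤ ρ₀ ∧ ∀ (y : Fin (n - 1) → ℂ) (t : ℂ),
      ‖y‖ < ρ₁ → ‖t‖ < ρ₁ →
        ‖G y t - B.mulVec y‖ ≤ C * (‖y‖ ^ 2 + ‖y‖ * ‖t‖ + ‖t‖ ^ (m + 1)) ∧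
        ‖F y t - t ^ (k + 1)‖ ≤ C * ‖y‖ ^ 2)
    (a b : ℝ) (hgood : IsGoodSectorFor k B a b) (r : ℝ) (hr : 0 < r) (hrρ : r ≤ ρ₀)
    (q : ℂ → (Fin (n - 1) → ℂ))
    (hq : DifferentiableOn ℂ q (SectorR a b r))
    (hqin : ∀ t ∈ SectorR a b r, ‖q t‖ < ρ₀)
    (hq0 : Filter.Tendsto q (nhdsWithin 0 (SectorR a b r)) (nhds 0))
    (hq' : ∃ M : ℝ, ∀ t ∈ SectorR a b r, ‖deriv q t‖ ≤ M)
    (htan : ∀ t ∈ SectorR a b r, F (q t) t • deriv q t = G (q t) t) :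
    q =o[nhdsWithin 0 (SectorR a b r)] fun t : ℂ => t ^ m := by
  obtain ⟨ρ₁, hρ₁, hρ₁₀, hest⟩ := hest
  obtain ⟨M₀, hM₀⟩ := hq'
  set M := max M₀ 0 with hM
  have hM0 : 0 ≤ M := le_max_right _ _
  have hderiv : ∀ t ∈ SectorR a b r, HasDerivAt q (deriv q t) t := fun t ht =>
    (hq.differentiableAt ((isOpen_sectorR a b r).mem_nhds ht)).hasDerivAt
  have hdM : ∀ t ∈ SectorR a b r, ‖deriv q t‖ ≤ M := fun t ht =>
    (hM₀ t ht).trans (le_max_left _ _)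
  have hqM : ∀ t ∈ SectorR a b r, ‖q t‖ ≤ M * ‖t‖ := fun t ht =>
    norm_le_mul_norm_of_norm_deriv_le hderiv hdM hq0 ht
  set s := min r (ρ₁ / (M + 1)) with hs
  have hs0 : 0 < s := lt_min hr (by positivity)
  have hsub : SectorR a b s ⊆ SectorR a b r :=
    inter_subset_inter_right _ (ball_subset_ball (min_le_left _ _))
  have hode : ∀ t ∈ SectorR a b s, ‖t ^ (k + 1) • deriv q t - B.mulVec (q t)‖ ≤
      |C| * (M * M + M + 1) * (‖q t‖ * ‖t‖ + ‖t‖ ^ (m + 1)) := fun t ht => by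
    have htr := hsub ht
    have hts : (M + 1) * ‖t‖ < ρ₁ := by
      rw [mul_comm, ← lt_div_iff₀ (by positivity)]
      exact (mem_ball_zero_iff.1 ht.2).trans_le (min_le_right _ _)
    have ht0 := norm_nonneg t
    have hMt : 0 ≤ M * ‖t‖ := by positivity
    have hqt := hqM t htr
    obtain ⟨hG, hF⟩ := hest (q t) t (by linarith) (by linarith)
    have hqq : ‖q t‖ ^ 2 ≤ M * (‖q t‖ * ‖t‖) := by
      nlinarith [mul_le_mul_of_nonneg_left hqt (norm_nonneg (q t))]
    have h1 : t ^ (k + 1) • deriv q t - B.mulVec (q t)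
        = (G (q t) t - B.mulVec (q t)) - (F (q t) t - t ^ (k + 1)) • deriv q t := by
      rw [sub_smul, htan t htr]; abel
    rw [h1]
    have hG' : ‖G (q t) t - B.mulVec (q t)‖ ≤
        |C| * (M * (‖q t‖ * ‖t‖) + ‖q t‖ * ‖t‖ + ‖t‖ ^ (m + 1)) :=
      hG.trans (by gcongr; exact le_abs_self C)
    have hF' : ‖(F (q t) t - t ^ (k + 1)) • deriv q t‖ ≤ |C| * (M * (‖q t‖ * ‖t‖)) * M := by
      rw [norm_smul]
      refine mul_le_mul (hF.trans ?_) (hdM t htr) (norm_nonneg _) (by positivity)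
      gcongr
      exact le_abs_self C
    have hrest : 0 ≤ |C| * (M * M + M) * ‖t‖ ^ (m + 1) := by positivity
    refine (norm_sub_le _ _).trans ((add_le_add hG' hF').trans ?_)
    linarith
  obtain ⟨R, hR, L, hL⟩ := hgood.exists_norm_le_mul_norm_pow (m := m) hB hk hs0
    (fun t ht => hderiv t (hsub ht)) (fun t ht => hqM t (hsub ht)) (by positivity) hode
  have hO : q =O[nhdsWithin 0 (SectorR a b r)] fun t : ℂ => t ^ (m + 1) := by
    refine IsBigO.of_bound L ?_
    filter_upwards [self_mem_nhdsWithin, mem_nhdsWithin_of_mem_nhds (ball_mem_nhds 0 hR)]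
      with t ht htR
    rw [norm_pow]
    exact hL t ⟨ht.1, htR⟩
  exact hO.trans_isLittleO ((isLittleO_pow_pow m.lt_succ_self).mono nhdsWithin_le_nhds)
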